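/- arXiv:2506.13591 — 7 statements merged into one kernel-verified Lean document; each statement's English description precedes it below -/
import Mathlib

section
/- Let (x) be a minimal reduction of a regular ideal I of R. Then the integral closure of I equals the integral closure of (x), and both equal x·R̄ ∩ R, where R̄ is the integral closure of R in its total ring of fractions. -/
open scoped nonZeroDivisors

noncomputable section

/-- `x ∈ R` is integral over the ideal `I`: it satisfies an equation of integral
dependence over `I`, i.e. a monic polynomial whose coefficient in degree
`deg - i` lies in `I ^ i`. -/
def IsIntegralOverIdeal {R : Type*} [CommRing R] (I : Ideal R) (x : R) : Prop :=
  ∃ p : Polynomial R, p.Monic ∧ (∀ i < p.natDegree, p.coeff i ∈ I ^ (p.natDegree - i)) ∧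
    Polynomial.eval x p = 0

/-- The integral closure of the ideal `I`, viewed as an `R`-submodule of `Q(R)`. -/
def intCl (R : Type*) [CommRing R] (I : Ideal R) : Submodule R (FractionRing R) :=
  Submodule.span R (algebraMap R (FractionRing R) '' {r : R | IsIntegralOverIdeal I r})

/-- `J` is a reduction of `I`: `J ⊆ I` and `J I^n = I^(n+1)` for some `n`. -/
def IsIdealReduction {R : Type*} [CommRing R] (J I : Ideal R) : Prop :=
  J ≤ I ∧ ∃ n : ℕ, J * I ^ n = I ^ (n + 1)

/-- `J` is a minimal reduction of `I`: no reduction of `I` is properly contained in `J`. -/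
def IsMinimalReduction {R : Type*} [CommRing R] (J I : Ideal R) : Prop :=
  IsIdealReduction J I ∧ ∀ K : Ideal R, IsIdealReduction K I → K ≤ J → K = J

/-- The ideal `I` of `R`, viewed as an `R`-submodule of `Q(R)`. -/
def idl (R : Type*) [CommRing R] (I : Ideal R) : Submodule R (FractionRing R) :=
  Submodule.map (Algebra.linearMap R (FractionRing R)) I

/-- The integral closure `R̄` of `R` in `Q(R)`, as an `R`-submodule of `Q(R)`. -/
def Rbar (R : Type*) [CommRing R] : Submodule R (FractionRing R) :=
  Subalgebra.toSubmodule (integralClosure R (FractionRing R))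

/-- The condC `C = R : R̄`, as an `R`-submodule of `Q(R)`. -/
def condC (R : Type*) [CommRing R] : Submodule R (FractionRing R) :=
  1 / Rbar R

/-- The product `z • I` of a submodule `I` of `Q(R)` by an element `z ∈ Q(R)`. -/
def smulQ {R : Type*} [CommRing R] (z : FractionRing R)
    (I : Submodule R (FractionRing R)) : Submodule R (FractionRing R) :=
  Submodule.span R {z} * I

/-- `I` is a (regular) fractional ideal of `R`: it contains a regular
(= invertible) element of `Q(R)`, and `yI ⊆ R` for some regular `y ∈ R`. -/
def IsFracIdeal {R : Type*} [CommRing R] (I : Submodule R (FractionRing R)) : Prop :=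
  (∃ u : (FractionRing R)ˣ, (u : FractionRing R) ∈ I) ∧
    ∃ y ∈ R⁰, smulQ (algebraMap R (FractionRing R) y) I ≤ 1

/-- `z ∈ Q(R)` is a reduction of the fractional ideal `F`: `z = x/y` with `y`
regular in `R`, `yF ⊆ R`, and `(x)` a minimal reduction of the ideal `yF` of `R`. -/
def IsFracReduction {R : Type*} [CommRing R] (z : FractionRing R)
    (F : Submodule R (FractionRing R)) : Prop :=
  ∃ x y : R, y ∈ R⁰ ∧
    z * algebraMap R (FractionRing R) y = algebraMap R (FractionRing R) x ∧
    smulQ (algebraMap R (FractionRing R) y) F ≤ 1 ∧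
    IsMinimalReduction (Ideal.span {x})
      (Submodule.comap (Algebra.linearMap R (FractionRing R))
        (smulQ (algebraMap R (FractionRing R) y) F))

/-- An element of an algebra that stabilises a finitely generated submodule containing an element
with trivial annihilator is integral. -/
theorem isIntegral_of_smul_mem_submodule_of_smul_eq_zero {R A M : Type*} [CommRing R] [CommRing A]
    [Algebra R A] [AddCommGroup M] [Module R M] [Module A M] [IsScalarTower R A M]
    (N : Submodule R M) (hN : N.FG) {m : M} (hmN : m ∈ N) (hm : ∀ s : A, s • m = 0 → s = 0)
    (x : A) (hx : ∀ n ∈ N, x • n ∈ N) : IsIntegral R x := by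
  let A' : Subalgebra R A :=
    { carrier := { x | ∀ n ∈ N, x • n ∈ N }
      mul_mem' := fun {a b} ha hb n hn => smul_smul a b n ▸ ha _ (hb _ hn)
      one_mem' := fun n hn => (one_smul A n).symm ▸ hn
      add_mem' := fun {a b} ha hb n hn => (add_smul a b n).symm ▸ N.add_mem (ha _ hn) (hb _ hn)
      zero_mem' := fun n _ => (zero_smul A n).symm ▸ N.zero_mem
      algebraMap_mem' := fun r n hn => (algebraMap_smul A r n).symm ▸ N.smul_mem r hn }
  let f : A' →ₐ[R] Module.End R N :=
    AlgHom.ofLinearMap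
      { toFun := fun x => (DistribSMul.toLinearMap R M x).restrict x.prop
        map_add' := by intro x y; ext; exact add_smul _ _ _
        map_smul' := by intro r s; ext; apply smul_assoc }
      (by ext; apply one_smul)
      (by intro x y; ext; apply mul_smul)
  have hf : Function.Injective f := by
    refine (injective_iff_map_eq_zero f).2 fun s hs => Subtype.ext (hm _ ?_)
    exact congr_arg Subtype.val (LinearMap.congr_fun hs ⟨m, hmN⟩)
  have : Module.Finite R N := Module.Finite.iff_fg.2 hN
  change IsIntegral R (A'.val ⟨x, hx⟩)
  rw [isIntegral_algHom_iff A'.val Subtype.val_injective, ← isIntegral_algHom_iff f hf]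
  exact Algebra.IsIntegral.isIntegral _

theorem IsIntegralOverIdeal.mono {R : Type*} [CommRing R] {I J : Ideal R} (h : J ≤ I) {r : R}
    (hr : IsIntegralOverIdeal J r) : IsIntegralOverIdeal I r := by
  obtain ⟨p, hp, hc, h0⟩ := hr
  exact ⟨p, hp, fun i hi => Ideal.pow_right_mono h _ (hc i hi), h0⟩

/-- If `I` contains a regular element, so does every principal reduction of `I`. -/
theorem IsIdealReduction.mem_nonZeroDivisors {R : Type*} [CommRing R] {I : Ideal R} {x : R}
    (hx : IsIdealReduction (Ideal.span {x}) I) (hI : ∃ r ∈ I, r ∈ R⁰) : x ∈ R⁰ := by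
  obtain ⟨-, n, hn⟩ := hx
  obtain ⟨r, hrI, hr⟩ := hI
  have h : r ^ (n + 1) ∈ Ideal.span {x} * I ^ n := hn ▸ Ideal.pow_mem_pow hrI _
  obtain ⟨c, -, hc⟩ := Ideal.mem_span_singleton_mul.1 h
  have h' : x * c ∈ R⁰ := hc ▸ pow_mem hr _
  exact (mul_mem_nonZeroDivisors.1 h').1

/-- If `(x)` is a reduction of `I` and `v = 1 / x`, then `v * a` is integral for `a ∈ I`. -/
theorem IsIdealReduction.isIntegral_inv_mul {R A : Type*} [CommRing R] [IsNoetherianRing R]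
    [CommRing A] [Algebra R A] [IsLocalization R⁰ A] {I : Ideal R} {x : R}
    (hx : IsIdealReduction (Ideal.span {x}) I) (hI : ∃ r ∈ I, r ∈ R⁰) {v : A}
    (hv : algebraMap R A x * v = 1) {a : R} (ha : a ∈ I) :
    IsIntegral R (v * algebraMap R A a) := by
  obtain ⟨-, n, hn⟩ := hx
  obtain ⟨r, hrI, hr⟩ := hI
  refine isIntegral_of_smul_mem_submodule_of_smul_eq_zero (Submodule.map (Algebra.linearMap R A) (I ^ n))
    (Submodule.FG.map _ (IsNoetherian.noetherian _))
    (m := algebraMap R A (r ^ n)) ⟨r ^ n, Ideal.pow_mem_pow hrI _, rfl⟩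
    (fun s => (IsLocalization.map_units A (⟨r ^ n, pow_mem hr n⟩ : R⁰)).mul_left_eq_zero.1) _ ?_
  rintro _ ⟨b, hb, rfl⟩
  have h : a * b ∈ Ideal.span {x} * I ^ n := by
    rw [hn, pow_succ']
    exact Ideal.mul_mem_mul ha hb
  obtain ⟨c, hc, hxc⟩ := Ideal.mem_span_singleton_mul.1 h
  refine ⟨c, hc, ?_⟩
  have h' := congr_arg (algebraMap R A) hxc
  simp only [map_mul] at h'
  simp only [Algebra.linearMap_apply, smul_eq_mul]
  linear_combination (-algebraMap R A c) * hv + v * h'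

/-- If `v * a` is integral for all `a ∈ I`, then `v ^ k * a` is integral for all `a ∈ I ^ k`. -/
theorem isIntegral_pow_mul_of_mem_pow {R A : Type*} [CommRing R] [CommRing A] [Algebra R A]
    {I : Ideal R} {v : A} (h : ∀ a ∈ I, IsIntegral R (v * algebraMap R A a)) (k : ℕ) {a : R}
    (ha : a ∈ I ^ k) : IsIntegral R (v ^ k * algebraMap R A a) := by
  let S (k : ℕ) : Ideal R := Submodule.comap (LinearMap.mulLeft R (v ^ k) ∘ₗ Algebra.linearMap R A)
    (Subalgebra.toSubmodule (integralClosure R A))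
  suffices hS : I ^ k ≤ S k from hS ha
  clear ha
  induction k with
  | zero =>
    intro a _
    change IsIntegral R (v ^ 0 * algebraMap R A a)
    simpa using isIntegral_algebraMap
  | succ k ih =>
    rw [pow_succ, Ideal.mul_le]
    intro b hb c hc
    change IsIntegral R (v ^ (k + 1) * algebraMap R A (b * c))
    have hb' : IsIntegral R (v ^ k * algebraMap R A b) := ih hb
    convert hb'.mul (h c hc) using 1
    rw [map_mul]
    ring

/-- If `v * a` is integral for all `a ∈ I`, then also for all `a` in the integral closure of `I`. -/
theorem IsIntegralOverIdeal.isIntegral_mul {R A : Type*} [CommRing R] [CommRing A] [Algebra R A]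
    {I : Ideal R} {v : A} (h : ∀ a ∈ I, IsIntegral R (v * algebraMap R A a)) {r : R}
    (hr : IsIntegralOverIdeal I r) : IsIntegral R (v * algebraMap R A r) := by
  nontriviality A
  have : Nontrivial R := (algebraMap R A).domain_nontrivial
  obtain ⟨p, hp, hc, h0⟩ := hr
  have hdeg : (p.map (algebraMap R A)).natDegree = p.natDegree := hp.natDegree_map _
  refine IsIntegral.of_aeval_monic_of_isIntegral_coeff
    (p := (p.map (algebraMap R A)).scaleRoots v)
    ((Polynomial.monic_scaleRoots_iff v).2 (hp.map _)) ?_ ?_ fun i => ?_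
  · rw [Polynomial.natDegree_scaleRoots, hdeg]
    intro hd
    rw [hp.natDegree_eq_zero.1 hd] at h0
    simp at h0
  · rw [Polynomial.scaleRoots_eval_mul, Polynomial.eval_map_apply, h0]
    simpa using isIntegral_zero
  · rw [Polynomial.coeff_scaleRoots, Polynomial.coeff_map, hdeg, mul_comm]
    rcases lt_trichotomy i p.natDegree with hi | rfl | hi
    · exact isIntegral_pow_mul_of_mem_pow h _ (hc i hi)
    · simpa [hp.coeff_natDegree] using isIntegral_one
    · simpa [Polynomial.coeff_eq_zero_of_natDegree_lt hi] using isIntegral_zero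

/-- Elements of `x R̄ ∩ R` are integral over `(x)`. -/
theorem IsIntegralOverIdeal.of_eq_mul {R A : Type*} [CommRing R] [CommRing A] [Algebra R A]
    [FaithfulSMul R A] {x r : R} {t : A} (ht : IsIntegral R t)
    (h : algebraMap R A x * t = algebraMap R A r) :
    IsIntegralOverIdeal (Ideal.span {x}) r := by
  obtain ⟨p, hp, h0⟩ := ht
  refine ⟨p.scaleRoots x, (Polynomial.monic_scaleRoots_iff x).2 hp, fun i _ => ?_, ?_⟩
  · rw [Polynomial.coeff_scaleRoots, Polynomial.natDegree_scaleRoots, Ideal.span_singleton_pow]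
    exact Ideal.mul_mem_left _ _ (Ideal.mem_span_singleton_self _)
  · apply FaithfulSMul.algebraMap_injective R A
    rw [map_zero, ← Polynomial.eval₂_at_apply, ← h]
    exact Polynomial.scaleRoots_eval₂_eq_zero _ h0

theorem statement_0
    (R : Type*) [CommRing R] [IsNoetherianRing R] [IsLocalRing R] [IsReduced R]
    (hdim : ringKrullDim R = 1)
    (hCM : ∃ x ∈ IsLocalRing.maximalIdeal R, x ∈ R⁰)
    [Infinite (IsLocalRing.ResidueField R)]
    (hfin : (Subalgebra.toSubmodule (integralClosure R (FractionRing R))).FG)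
    (I : Ideal R) (hIreg : ∃ r ∈ I, r ∈ R⁰)
    (x : R) (hx : IsMinimalReduction (Ideal.span {x}) I) :
    {r : R | IsIntegralOverIdeal I r} = {r : R | IsIntegralOverIdeal (Ideal.span {x}) r} ∧
    {r : R | IsIntegralOverIdeal I r} =
      {r : R | algebraMap R (FractionRing R) r ∈
        smulQ (algebraMap R (FractionRing R) x) (Rbar R)} := by
  have hxr : x ∈ R⁰ := hx.1.mem_nonZeroDivisors hIreg
  obtain ⟨v, hv⟩ := (IsLocalization.map_units (FractionRing R) (⟨x, hxr⟩ : R⁰)).exists_right_inv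
  have to_bar {r : R} (hr : IsIntegralOverIdeal I r) : algebraMap R (FractionRing R) r ∈
      smulQ (algebraMap R (FractionRing R) x) (Rbar R) :=
    Submodule.mem_span_singleton_mul.2 ⟨v * algebraMap R (FractionRing R) r,
      hr.isIntegral_mul fun a ha => hx.1.isIntegral_inv_mul hIreg hv ha,
      by rw [← mul_assoc, hv, one_mul]⟩
  have of_bar {r : R} (hr : algebraMap R (FractionRing R) r ∈
      smulQ (algebraMap R (FractionRing R) x) (Rbar R)) :
      IsIntegralOverIdeal (Ideal.span {x}) r := by
    obtain ⟨t, ht, hxt⟩ := Submodule.mem_span_singleton_mul.1 hr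
    exact .of_eq_mul (A := FractionRing R) ht hxt
  exact ⟨Set.ext fun r => ⟨fun hr => of_bar (to_bar hr), .mono hx.1.1⟩,
    Set.ext fun r => ⟨to_bar, fun hr => (of_bar hr).mono hx.1.1⟩⟩
end
end

section
/- Let I be a fractional ideal of R and let z be a reduction of the fractional ideal ω_R:I. Then C ⊆ zI ⊆ ω_R. In particular, every fractional ideal is isomorphic to a fractional ideal lying between the conductor C and ω_R. -/
open scoped nonZeroDivisors

noncomputable section

/-- An element multiplying a finitely generated submodule containing a unit into itself is
integral. -/
theorem isIntegral_of_forall_mul_mem {S Q : Type*} [CommRing S] [CommRing Q] [Algebra S Q]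
    {N : Submodule S Q} (hN : N.FG) {v : Q} (hv : IsUnit v) (hvN : v ∈ N) {q : Q}
    (hq : ∀ n ∈ N, q * n ∈ N) : IsIntegral S q := by
  have : Module.Finite S N := Module.Finite.iff_fg.mpr hN
  let f : Module.End S N := (LinearMap.mulLeft S q).restrict hq
  have hf : IsIntegral S f := Algebra.IsIntegral.isIntegral f
  obtain ⟨p, hp, hpf⟩ := hf
  have hpow (k : ℕ) (n : N) : ((f ^ k) n : Q) = q ^ k * n := by
    induction k with
    | zero => simp
    | succ k ih =>
      rw [pow_succ', pow_succ', mul_assoc, ← ih]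
      rfl
  refine ⟨p, hp, hv.mul_left_eq_zero.mp ?_⟩
  have h := congrArg Subtype.val (LinearMap.congr_fun hpf ⟨v, hvN⟩)
  rw [← Polynomial.aeval_def, Polynomial.aeval_eq_sum_range] at h ⊢
  simpa [LinearMap.sum_apply, hpow, Finset.sum_mul] using h

/-- Over a noetherian ring that is integrally closed in `Q` and whose maximal ideals are minimal
over principal ideals generated by units of `Q`, regular fractional ideals are invertible. -/
theorem one_div_mul_self_eq_one {S Q : Type*} [CommRing S] [CommRing Q] [Algebra S Q]
    [IsNoetherianRing S] [IsIntegrallyClosedIn S Q]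
    (hS : ∀ M : Ideal S, M.IsMaximal →
      ∃ a, IsUnit (algebraMap S Q a) ∧ M ∈ (Ideal.span {a}).minimalPrimes)
    {L : Submodule S Q} (u : Qˣ) (hu : (u : Q) ∈ L)
    {v : Q} (hv : IsUnit v) (hvL : v ∈ 1 / L) : 1 / L * L = 1 := by
  have hFG : (1 / L).FG := by
    refine Submodule.FG.of_le (T := (1 : Submodule S Q).map (LinearMap.mulLeft S (↑u⁻¹ : Q)))
      (Submodule.FG.map _
        (Submodule.one_eq_span (R := S) (A := Q) ▸ Submodule.fg_span_singleton 1)) ?_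
    intro x hx
    exact ⟨u * x, mul_comm x (u : Q) ▸ Submodule.mem_div_iff_forall_mul_mem.mp hx u hu, by simp⟩
  have hle : 1 / L * L ≤ 1 := Submodule.le_div_iff_mul_le.mp le_rfl
  refine le_antisymm hle ?_
  by_contra hne
  have htop : (1 / L * L).comap (Algebra.linearMap S Q) ≠ ⊤ := by
    intro h
    refine hne (Submodule.one_le.mpr ?_)
    have h1 : (1 : S) ∈ (1 / L * L).comap (Algebra.linearMap S Q) := h ▸ Submodule.mem_top
    simpa using h1
  obtain ⟨M, hM, hLM⟩ := Ideal.exists_le_maximal _ htop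
  obtain ⟨a, ha, haM⟩ := hS M hM
  have hcol : (Ideal.span {a}).colon {(1 : S)} = Ideal.span {a} := by
    ext; simp [Submodule.mem_colon_singleton]
  obtain ⟨b, rfl⟩ := Submodule.exists_eq_colon_of_mem_minimalPrimes (hcol.symm ▸ haM)
  obtain ⟨c, hc⟩ := ha
  have hint : IsIntegral S (algebraMap S Q b * ↑c⁻¹) := by
    refine isIntegral_of_forall_mul_mem hFG hv hvL fun n hn l hl ↦ ?_
    obtain ⟨s, hs⟩ := Submodule.mem_one.mp (hle (Submodule.mul_mem_mul hn hl))
    have hsM := hLM (Submodule.mem_comap.mpr (hs.symm ▸ Submodule.mul_mem_mul hn hl :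
      algebraMap S Q s ∈ 1 / L * L))
    rw [Submodule.mem_colon_singleton, smul_eq_mul, Ideal.mem_span_singleton] at hsM
    obtain ⟨t, ht⟩ := hsM
    refine Submodule.mem_one.mpr ⟨t, ?_⟩
    have h2 := congrArg (algebraMap S Q) ht
    rw [map_mul, map_mul, hs, ← hc] at h2
    calc algebraMap S Q t = c * algebraMap S Q t * ↑c⁻¹ := by
          rw [mul_comm (c : Q), Units.mul_inv_cancel_right]
      _ = _ := by rw [← h2]; ring
  obtain ⟨t, ht⟩ := IsIntegrallyClosedIn.isIntegral_iff.mp hint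
  refine hM.ne_top ((Ideal.eq_top_iff_one _).mpr ?_)
  rw [Submodule.mem_colon_singleton, one_smul, Ideal.mem_span_singleton]
  refine ⟨t, (isIntegrallyClosedIn_iff.mp ‹IsIntegrallyClosedIn S Q›).1 ?_⟩
  rw [map_mul, ht, ← hc, mul_comm, Units.inv_mul_cancel_right]

/-- Over a local ring with infinite residue field, a module is not covered by finitely many proper
submodules. -/
theorem exists_forall_notMem_of_ne_top {R M ι : Type*} [CommRing R] [IsLocalRing R]
    [Infinite (IsLocalRing.ResidueField R)] [AddCommGroup M] [Module R M] [Finite ι]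
    (p : ι → Submodule R M) (hp : ∀ i, p i ≠ ⊤) :
    ∃ x, ∀ i, x ∉ p i := by
  by_contra! h
  have := Fintype.ofFinite ι
  obtain ⟨i, -, hi⟩ := Submodule.exists_finiteIndex_of_cover (p := p) (s := Finset.univ)
    (Set.eq_univ_of_forall fun x ↦ by simpa using h x)
  have : Finite (M ⧸ p i) := AddSubgroup.finite_quotient_of_finiteIndex
  obtain ⟨x, hx⟩ : ∃ x, x ∉ p i := by
    by_contra! hx
    exact hp i (eq_top_iff.mpr fun x _ ↦ hx x)
  have hsurj := IsLocalRing.residue_surjective (R := R)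
  refine not_injective_infinite_finite
    (fun k : IsLocalRing.ResidueField R ↦ (p i).mkQ (Function.surjInv hsurj k • x))
    fun k l hkl ↦ ?_
  by_contra hne
  set r := Function.surjInv hsurj k
  set s := Function.surjInv hsurj l
  have hrs : IsUnit (r - s) := by
    rw [← IsLocalRing.residue_ne_zero_iff_isUnit, map_sub, Function.surjInv_eq hsurj k,
      Function.surjInv_eq hsurj l, sub_ne_zero]
    exact hne
  have hmem : (r - s) • x ∈ p i := by
    rw [sub_smul]
    exact (Submodule.Quotient.eq _).mp hkl
  exact hx ((Submodule.smul_mem_iff_of_isUnit _ hrs).mp hmem)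

/-- In a one-dimensional local ring, a prime containing a regular element is maximal. -/
theorem eq_maximalIdeal_of_mem_nonZeroDivisors {R : Type*} [CommRing R] [IsLocalRing R]
    (hdim : ringKrullDim R = 1) {a : R} (ha : a ∈ R⁰) {P : Ideal R} (hP : P.IsPrime) (haP : a ∈ P) :
    P = IsLocalRing.maximalIdeal R := by
  have : Ring.KrullDimLE 1 R := (Order.krullDimLE_iff 1 _).mpr hdim.le
  rcases Ring.krullDimLE_one_iff.mp this P hP with h | h
  · exact absurd ha (notMem_nonZeroDivisors_of_mem_mem_minimalPrimes haP h)
  · exact IsLocalRing.eq_maximalIdeal h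

/-- The maximal ideals of an integral extension of a one-dimensional local ring are minimal over
any regular nonunit of the base. -/
theorem mem_minimalPrimes_span_algebraMap {R S : Type*} [CommRing R] [IsLocalRing R] [CommRing S]
    [Algebra R S] [Algebra.IsIntegral R S] (hdim : ringKrullDim R = 1) {a : R} (ha : a ∈ R⁰)
    (ham : a ∈ IsLocalRing.maximalIdeal R) {M : Ideal S} (hM : M.IsMaximal) :
    M ∈ (Ideal.span {algebraMap R S a}).minimalPrimes := by
  have hcomap : M.comap (algebraMap R S) = IsLocalRing.maximalIdeal R :=
    IsLocalRing.eq_maximalIdeal (Ideal.isMaximal_comap_of_isIntegral_of_isMaximal M)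
  refine ⟨⟨hM.isPrime, ?_⟩, fun P ⟨hP, haP⟩ hPM ↦ ?_⟩
  · rw [Ideal.span_singleton_le_iff_mem, ← Ideal.mem_comap, hcomap]
    exact ham
  · rw [Ideal.span_singleton_le_iff_mem, ← Ideal.mem_comap] at haP
    have hPmax : (P.comap (algebraMap R S)).IsMaximal := by
      rw [eq_maximalIdeal_of_mem_nonZeroDivisors hdim ha (hP.comap _) haP]
      infer_instance
    exact ((Ideal.isMaximal_of_isIntegral_of_isMaximal_comap P hPmax).eq_of_le hM.ne_top hPM).ge

theorem mem_smulQ {R : Type*} [CommRing R] {z x : FractionRing R}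
    {I : Submodule R (FractionRing R)} : x ∈ smulQ z I ↔ ∃ i ∈ I, z * i = x :=
  Submodule.mem_span_singleton_mul

theorem isUnit_algebraMap_fractionRing_iff {R : Type*} [CommRing R] {r : R} :
    IsUnit (algebraMap R (FractionRing R) r) ↔ r ∈ R⁰ :=
  ⟨fun h ↦ mem_nonZeroDivisors_of_injective (IsFractionRing.injective R (FractionRing R))
    h.mem_nonZeroDivisors, fun h ↦ IsLocalization.map_units (FractionRing R) ⟨r, h⟩⟩

/-- A fractional ideal has an invertible element dividing every other one in `R̄`. -/
theorem IsFracIdeal.exists_unit_forall_mul_inv_mem {R : Type*} [CommRing R] [IsNoetherianRing R]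
    [IsLocalRing R] (hdim : ringKrullDim R = 1)
    (hCM : ∃ x ∈ IsLocalRing.maximalIdeal R, x ∈ R⁰)
    [Infinite (IsLocalRing.ResidueField R)]
    (hfin : (Subalgebra.toSubmodule (integralClosure R (FractionRing R))).FG)
    {F : Submodule R (FractionRing R)} (hF : IsFracIdeal F) :
    ∃ w : (FractionRing R)ˣ, (w : FractionRing R) ∈ F ∧
      ∀ f ∈ F, f * (↑w⁻¹ : FractionRing R) ∈ Rbar R := by
  obtain ⟨a, ham, ha⟩ := hCM
  obtain ⟨⟨u, hu⟩, y, hy, hyF⟩ := hF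
  let S := integralClosure R (FractionRing R)
  have : Module.Finite R S := Module.Finite.iff_fg.mpr hfin
  have : IsNoetherianRing S := IsNoetherianRing.of_finite R S
  let L : Submodule S (FractionRing R) := Submodule.span S F
  have hFL {f} (hf : f ∈ F) : f ∈ L := Submodule.subset_span hf
  have hau : IsUnit (algebraMap S (FractionRing R) (algebraMap R S a)) :=
    isUnit_algebraMap_fractionRing_iff.mpr ha
  have hmin {M : Ideal S} (hM : M.IsMaximal) :
      M ∈ (Ideal.span {algebraMap R S a}).minimalPrimes :=
    mem_minimalPrimes_span_algebraMap hdim ha ham hM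
  have hyL : algebraMap R (FractionRing R) y ∈ 1 / L := by
    rw [← Submodule.span_singleton_le_iff_mem, Submodule.le_div_iff_mul_le,
      Submodule.span_mul_span, Submodule.span_le]
    rintro _ ⟨_, rfl, f, hf, rfl⟩
    obtain ⟨r, hr⟩ := Submodule.mem_one.mp (hyF (mem_smulQ.mpr ⟨f, hf, rfl⟩))
    exact Submodule.mem_one.mpr ⟨algebraMap R S r, hr⟩
  have hL : 1 / L * L = 1 := one_div_mul_self_eq_one
    (fun M hM ↦ ⟨algebraMap R S a, hau, hmin hM⟩) u (hFL hu) (isUnit_algebraMap_fractionRing_iff.mpr hy) hyL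
  have hone {M : Ideal S} (hM : M.IsMaximal)
      (h : (1 : FractionRing R) ∈ Submodule.map (Algebra.linearMap S (FractionRing R)) M) : False := by
    obtain ⟨s, hs, h1⟩ := h
    have hs1 : s = 1 := Subtype.ext h1
    exact hM.ne_top ((Ideal.eq_top_iff_one _).mpr (hs1 ▸ hs))
  have : Finite {M : Ideal S // M.IsMaximal} :=
    ((Ideal.finite_minimalPrimes_of_isNoetherianRing S _).subset fun _ ↦ hmin).to_subtype
  obtain ⟨⟨w, hw⟩, hwp⟩ := exists_forall_notMem_of_ne_top (M := F)
    (fun M : {M : Ideal S // M.IsMaximal} ↦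
      ((Submodule.map (Algebra.linearMap S (FractionRing R)) M.1 / (1 / L)).restrictScalars
        R).comap F.subtype)
    (by
      rintro ⟨M, hM⟩ htop
      refine hone hM ?_
      have hle : L ≤ Submodule.map (Algebra.linearMap S (FractionRing R)) M / (1 / L) :=
        Submodule.span_le.mpr fun f hf ↦ by
          have h : (⟨f, hf⟩ : F) ∈ (⊤ : Submodule R F) := Submodule.mem_top
          rwa [← htop] at h
      rw [Submodule.le_div_iff_mul_le, mul_comm, hL] at hle
      exact Submodule.one_le.mp hle)
  obtain ⟨l, hl, hlw⟩ : ∃ l ∈ 1 / L, l * w = 1 := by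
    rw [← Submodule.mem_mul_span_singleton]
    by_contra hne
    have htop : (1 / L * Submodule.span S {w}).comap (Algebra.linearMap S (FractionRing R)) ≠ ⊤ :=
      fun h ↦ hne (by
        have h1 : (1 : S) ∈ (⊤ : Ideal S) := Submodule.mem_top
        rw [← h] at h1
        simpa using h1)
    obtain ⟨M, hM, hle⟩ := Ideal.exists_le_maximal _ htop
    refine hwp ⟨M, hM⟩ fun l hl ↦ ?_
    obtain ⟨s, hs⟩ := Submodule.mem_one.mp (Submodule.mem_div_iff_forall_mul_mem.mp hl w (hFL hw))
    exact ⟨s, hle (Submodule.mem_comap.mpr (Submodule.mem_mul_span_singleton.mpr ⟨l, hl, hs.symm⟩)),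
      hs.trans (mul_comm l w)⟩
  refine ⟨⟨w, l, mul_comm l w ▸ hlw, hlw⟩, hw, fun f hf ↦ ?_⟩
  obtain ⟨s, hs⟩ := Submodule.mem_one.mp (Submodule.mem_div_iff_forall_mul_mem.mp hl f (hFL hf))
  change f * l ∈ Rbar R
  rw [mul_comm, ← hs]
  exact s.2

theorem IsFracIdeal.div {R : Type*} [CommRing R] {A B : Submodule R (FractionRing R)}
    (hA : IsFracIdeal A) (hB : IsFracIdeal B) : IsFracIdeal (A / B) := by
  obtain ⟨⟨u, hu⟩, y, hy, hyA⟩ := hA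
  obtain ⟨⟨v, hv⟩, t, ht, htB⟩ := hB
  refine ⟨⟨u * (isUnit_algebraMap_fractionRing_iff.mpr ht).unit, fun b hb ↦ ?_⟩, ?_⟩
  · obtain ⟨r, hr⟩ := Submodule.mem_one.mp (htB (mem_smulQ.mpr ⟨b, hb, rfl⟩))
    have h := A.smul_mem r hu
    rwa [Algebra.smul_def, hr, mul_comm, ← mul_assoc] at h
  · obtain ⟨⟨p, s⟩, hps⟩ := IsLocalization.surj R⁰ (v : FractionRing R)
    have hp : p ∈ R⁰ := isUnit_algebraMap_fractionRing_iff.mp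
      (hps ▸ v.isUnit.mul (IsLocalization.map_units _ s))
    refine ⟨y * p, mul_mem hy hp, fun x hx ↦ ?_⟩
    obtain ⟨q, hq, rfl⟩ := mem_smulQ.mp hx
    obtain ⟨r, hr⟩ := Submodule.mem_one.mp (hyA (mem_smulQ.mpr ⟨q * v, hq v hv, rfl⟩))
    refine Submodule.mem_one.mpr ⟨r * s, ?_⟩
    rw [map_mul, map_mul, hr, ← hps]
    ring

/-- If `w ∈ ω : I` is invertible and divides every element of `ω : I` in `R̄`, then
`C ⊆ w I ⊆ ω`. -/
theorem condC_le_smulQ_le {R : Type*} [CommRing R] {ω I : Submodule R (FractionRing R)}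
    (hω1 : 1 ≤ ω) (hωI : ω / (ω / I) = I) (w : (FractionRing R)ˣ)
    (hw : (w : FractionRing R) ∈ ω / I)
    (hint : ∀ f ∈ ω / I, f * (↑w⁻¹ : FractionRing R) ∈ Rbar R) :
    condC R ≤ smulQ (w : FractionRing R) I ∧ smulQ (w : FractionRing R) I ≤ ω := by
  constructor
  · intro c hc
    refine mem_smulQ.mpr ⟨↑w⁻¹ * c, ?_, by simp⟩
    rw [← hωI]
    intro f hf
    have h := hω1 (Submodule.mem_div_iff_forall_mul_mem.mp hc _ (hint f hf))
    rwa [show (↑w⁻¹ : FractionRing R) * c * f = c * (f * ↑w⁻¹) by ring]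
  · intro x hx
    obtain ⟨i, hi, rfl⟩ := mem_smulQ.mp hx
    exact hw i hi

/-- A reduction of a fractional ideal `F` is an invertible element of `F` dividing every other
element of `F` in `R̄`. -/
theorem IsFracReduction.exists_unit {R : Type*} [CommRing R] [IsNoetherianRing R]
    {F : Submodule R (FractionRing R)} (hF : IsFracIdeal F) {z : FractionRing R}
    (hz : IsFracReduction z F) :
    ∃ w : (FractionRing R)ˣ, (w : FractionRing R) = z ∧ z ∈ F ∧
      ∀ f ∈ F, f * (↑w⁻¹ : FractionRing R) ∈ Rbar R := by
  obtain ⟨x, y, hy, hzy, hyF, ⟨hxle, n, hn⟩, -⟩ := hz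
  obtain ⟨⟨u, hu⟩, -⟩ := hF
  have hyu := isUnit_algebraMap_fractionRing_iff.mpr hy
  set I := Submodule.comap (Algebra.linearMap R (FractionRing R))
    (smulQ (algebraMap R (FractionRing R) y) F)
  have hlift {f : FractionRing R} (hf : f ∈ F) :
      ∃ r ∈ I, algebraMap R (FractionRing R) r = algebraMap R (FractionRing R) y * f := by
    have hyf := (mem_smulQ (z := algebraMap R (FractionRing R) y)).mpr ⟨f, hf, rfl⟩
    obtain ⟨r, hr⟩ := Submodule.mem_one.mp (hyF hyf)
    exact ⟨r, Submodule.mem_comap.mpr (hr.symm ▸ hyf : algebraMap R _ r ∈ _), hr⟩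
  obtain ⟨r, hrI, hr⟩ := hlift hu
  have hru : IsUnit (algebraMap R (FractionRing R) r) := hr ▸ hyu.mul u.isUnit
  have hxu : IsUnit (algebraMap R (FractionRing R) x) := by
    have h := Ideal.pow_mem_pow hrI (n + 1)
    rw [← hn, Ideal.mem_span_singleton_mul] at h
    obtain ⟨s, -, hs⟩ := h
    have h := hru.pow (n + 1)
    rw [← map_pow, ← hs, map_mul] at h
    exact isUnit_of_mul_isUnit_left h
  obtain ⟨w, rfl⟩ : IsUnit z := isUnit_of_mul_isUnit_left (hzy ▸ hxu)
  refine ⟨w, rfl, ?_, fun f hf ↦ ?_⟩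
  · obtain ⟨f, hf, hfx⟩ := mem_smulQ.mp (hxle (Ideal.mem_span_singleton_self x))
    have hwf : (w : FractionRing R) = f :=
      hyu.mul_left_cancel (((mul_comm _ _).trans hzy).trans hfx.symm)
    exact hwf ▸ hf
  · obtain ⟨s, hsI, hs⟩ := hlift hf
    refine isIntegral_of_forall_mul_mem (N := (I ^ n).map (Algebra.linearMap R (FractionRing R)))
      (Submodule.FG.map _ (IsNoetherian.noetherian _)) (hru.pow n)
      ⟨r ^ n, Ideal.pow_mem_pow hrI n, map_pow (algebraMap R _) _ _⟩ ?_
    rintro _ ⟨m, hm, rfl⟩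
    have h := Ideal.mul_mem_mul hsI hm
    rw [← pow_succ', ← hn, Ideal.mem_span_singleton_mul] at h
    obtain ⟨m', hm', hmul⟩ := h
    refine ⟨m', hm', hxu.mul_left_cancel ?_⟩
    change algebraMap R _ x * algebraMap R _ m' = algebraMap R _ x * (f * ↑w⁻¹ * algebraMap R _ m)
    rw [← map_mul, hmul, map_mul, hs, ← hzy]
    calc _ = (w * ↑w⁻¹ : FractionRing R) * (algebraMap R _ y * f * algebraMap R _ m) := by
          rw [Units.mul_inv, one_mul]
      _ = _ := by ring

theorem statement_2
    (R : Type*) [CommRing R] [IsNoetherianRing R] [IsLocalRing R] [IsReduced R]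
    (hdim : ringKrullDim R = 1)
    (hCM : ∃ x ∈ IsLocalRing.maximalIdeal R, x ∈ R⁰)
    [Infinite (IsLocalRing.ResidueField R)]
    (hfin : (Subalgebra.toSubmodule (integralClosure R (FractionRing R))).FG)
    (ω : Submodule R (FractionRing R)) (hωfrac : IsFracIdeal ω)
    (hω1 : 1 ≤ ω) (hω2 : ω ≤ Rbar R)
    (hωcan : ∀ I : Submodule R (FractionRing R), IsFracIdeal I → ω / (ω / I) = I)
    (I : Submodule R (FractionRing R)) (hI : IsFracIdeal I)
    (z : FractionRing R) (hz : IsFracReduction z (ω / I)) :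
    (condC R ≤ smulQ z I ∧ smulQ z I ≤ ω) ∧
    ∀ J : Submodule R (FractionRing R), IsFracIdeal J →
      ∃ u : (FractionRing R)ˣ,
        condC R ≤ smulQ (u : FractionRing R) J ∧ smulQ (u : FractionRing R) J ≤ ω := by
  have hred {J : Submodule R (FractionRing R)} (hJ : IsFracIdeal J) : IsFracIdeal (ω / J) :=
    hωfrac.div hJ
  refine ⟨?_, fun J hJ ↦ ?_⟩
  · obtain ⟨w, rfl, hw, hint⟩ := hz.exists_unit (hred hI)
    exact condC_le_smulQ_le hω1 (hωcan I hI) w hw hint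
  · obtain ⟨w, hw, hint⟩ := (hred hJ).exists_unit_forall_mul_inv_mem hdim hCM hfin
    exact ⟨w, condC_le_smulQ_le hω1 (hωcan J hJ) w hw hint⟩
end
end

section
/- Let I be a proper regular ideal of R containing the conductor C, and let J be an integrally closed regular ideal of R with I ⊆ J. Then R:I = J:I. -/
open scoped nonZeroDivisors

noncomputable section

open Polynomial in
/-- If `x ∈ Q` is integral over `R` and `i ∈ J`, then a multiple `i x` lying in `R` is integral
over the ideal `J`. -/
theorem IsIntegral.isIntegralOverIdeal_of_algebraMap_mul_eq {R Q : Type*} [CommRing R] [CommRing Q]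
    [Algebra R Q] (hinj : Function.Injective (algebraMap R Q)) {J : Ideal R} {x : Q}
    (hx : IsIntegral R x) {i r : R} (hi : i ∈ J)
    (hr : algebraMap R Q r = algebraMap R Q i * x) : IsIntegralOverIdeal J r := by
  obtain ⟨p, hp, hpx⟩ := hx
  refine ⟨p.scaleRoots i, (monic_scaleRoots_iff i).mpr hp, fun k _ => ?_, hinj ?_⟩
  · rw [coeff_scaleRoots, natDegree_scaleRoots]
    exact Ideal.mul_mem_left _ _ (Ideal.pow_mem_pow hi _)
  · have h := scaleRoots_eval₂_eq_zero (algebraMap R Q) (s := i) hpx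
    rwa [← hr, eval₂_at_apply, ← map_zero (algebraMap R Q)] at h

/-- If all powers of `x` have a common non-zero-divisor denominator, then `x` is integral. -/
theorem isIntegral_of_forall_pow_mul_mem_one {R Q : Type*} [CommRing R] [IsNoetherianRing R]
    [CommRing Q] [Algebra R Q] {c x : Q} (hc : IsUnit c)
    (h : ∀ n : ℕ, x ^ n * c ∈ (1 : Submodule R Q)) : IsIntegral R x := by
  have hle : ∀ a ∈ Subalgebra.toSubmodule (Algebra.adjoin R {x}),
      a * c ∈ (1 : Submodule R Q) := by
    intro a ha
    rw [Algebra.adjoin_singleton_eq_range_aeval] at ha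
    obtain ⟨p, rfl⟩ := ha
    induction p using Polynomial.induction_on' with
    | add p q hp hq => simpa [add_mul] using add_mem hp hq
    | monomial n a => simpa [mul_assoc, ← Algebra.smul_def] using Submodule.smul_mem _ a (h n)
  have : IsNoetherian R (1 : Submodule R Q) :=
    isNoetherian_of_fg_of_noetherian _ (by
      rw [Submodule.one_eq_span]; exact Submodule.fg_span_singleton 1)
  let f : Subalgebra.toSubmodule (Algebra.adjoin R {x}) →ₗ[R] (1 : Submodule R Q) :=
    (LinearMap.mulRight R c).restrict hle
  have hf : Function.Injective f := fun a b hab =>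
    Subtype.ext (hc.mul_left_injective (congrArg Subtype.val hab))
  exact isIntegral_of_submodule_noetherian _ (isNoetherian_of_injective f hf) x
    (Algebra.self_mem_adjoin_singleton R x)

/-- If the integral closure is finite, then the conductor contains a unit of `Q(R)`. -/
theorem exists_isUnit_mem_condC {R : Type*} [CommRing R]
    (hfin : (Subalgebra.toSubmodule (integralClosure R (FractionRing R))).FG) :
    ∃ c ∈ condC R, IsUnit c := by
  obtain ⟨s, hs⟩ := hfin
  obtain ⟨b, hb⟩ := IsLocalization.exist_integer_multiples_of_finset R⁰ s
  refine ⟨algebraMap R _ b, fun y hy => ?_, IsLocalization.map_units _ b⟩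
  rw [← Algebra.smul_def]
  have hle : Submodule.span R (s : Set (FractionRing R)) ≤
      (1 : Submodule R (FractionRing R)).comap (LinearMap.lsmul R _ (b : R)) :=
    Submodule.span_le.mpr fun a ha => by
      obtain ⟨r, hr⟩ := hb a ha
      exact Submodule.mem_one.mpr ⟨r, hr⟩
  exact hle (hs ▸ hy)

theorem condC_le_one (R : Type*) [CommRing R] : condC R ≤ 1 := fun c hc => by
  simpa using hc 1 (one_mem (integralClosure R (FractionRing R)))

/-- An element sending the conductor into `R` sends it into itself. -/
theorem mul_mem_condC {R : Type*} [CommRing R] {x : FractionRing R}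
    (hx : ∀ c ∈ condC R, x * c ∈ (1 : Submodule R (FractionRing R)))
    {c : FractionRing R} (hc : c ∈ condC R) : x * c ∈ condC R := by
  intro y hy
  rw [mul_assoc]
  refine hx _ fun z hz => ?_
  rw [mul_assoc]
  exact hc _ ((integralClosure R (FractionRing R)).mul_mem hy hz)

theorem statement_4
    (R : Type*) [CommRing R] [IsNoetherianRing R] [IsLocalRing R] [IsReduced R]
    (hdim : ringKrullDim R = 1)
    (hCM : ∃ x ∈ IsLocalRing.maximalIdeal R, x ∈ R⁰)
    [Infinite (IsLocalRing.ResidueField R)]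
    (hfin : (Subalgebra.toSubmodule (integralClosure R (FractionRing R))).FG)
    (I : Ideal R) (hIreg : ∃ r ∈ I, r ∈ R⁰) (hIproper : I ≠ ⊤)
    (hCI : condC R ≤ idl R I)
    (J : Ideal R) (hJreg : ∃ r ∈ J, r ∈ R⁰)
    (hJic : ∀ r : R, IsIntegralOverIdeal J r → r ∈ J)
    (hIJ : I ≤ J) :
    (1 : Submodule R (FractionRing R)) / idl R I = idl R J / idl R I := by
  refine le_antisymm (fun x hx => ?_) fun x hx y hy => ?_
  · have hxC : ∀ c ∈ condC R, x * c ∈ (1 : Submodule R (FractionRing R)) :=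
      fun c hc => hx c (hCI hc)
    obtain ⟨c, hc, hcu⟩ := exists_isUnit_mem_condC hfin
    have hpow : ∀ n : ℕ, x ^ n * c ∈ condC R := by
      intro n
      induction n with
      | zero => simpa using hc
      | succ n ih => simpa [pow_succ', mul_assoc] using mul_mem_condC hxC ih
    have hint : IsIntegral R x :=
      isIntegral_of_forall_pow_mul_mem_one hcu fun n => condC_le_one R (hpow n)
    rintro _ ⟨i, hi, rfl⟩
    obtain ⟨r, hr⟩ := Submodule.mem_one.mp (hx _ ⟨i, hi, rfl⟩)
    refine ⟨r, hJic r ?_, hr⟩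
    exact hint.isIntegralOverIdeal_of_algebraMap_mul_eq
      (IsFractionRing.injective R (FractionRing R)) (hIJ hi) (hr.trans (mul_comm _ _))
  · obtain ⟨r, -, hr⟩ := hx y hy
    exact Submodule.mem_one.mpr ⟨r, hr⟩
end
end

section
/- Let I be a proper, non-principal, reflexive regular ideal of R containing the conductor C, and let J be an integrally closed regular ideal of R with I ⊆ J. Then J:J ⊆ I:I. -/
open scoped nonZeroDivisors

noncomputable section

/-- An element of a commutative algebra which stabilizes a finitely generated submodule
containing a non-zero-divisor is integral. -/
theorem isIntegral_of_mul_mem_of_fg {R A : Type*} [CommRing R] [CommRing A] [Algebra R A]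
    {N : Submodule R A} (hN : N.FG) {c : A} (hcN : c ∈ N) (hc : c ∈ A⁰) {x : A}
    (hx : ∀ n ∈ N, x * n ∈ N) : IsIntegral R x := by
  have : Module.Finite R N := Module.Finite.iff_fg.mpr hN
  let f : Module.End R N := (LinearMap.mulLeft R x).restrict hx
  obtain ⟨p, hp, hpf⟩ := LinearMap.exists_monic_and_aeval_eq_zero R f
  have key (q : Polynomial R) (n : N) :
      ((Polynomial.aeval f q n : N) : A) = Polynomial.aeval x q * n := by
    induction q using Polynomial.induction_on generalizing n with
    | C a => simp [Algebra.smul_def]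
    | add p q hp hq => simp [hp, hq, add_mul]
    | monomial k a ih =>
      have hfn : ((f n : N) : A) = x * n := rfl
      rw [pow_succ, ← mul_assoc, map_mul _ _ Polynomial.X, Polynomial.aeval_X,
        Module.End.mul_apply, ih, hfn, map_mul _ (_ * _) Polynomial.X, Polynomial.aeval_X,
        mul_assoc]
  refine ⟨p, hp, ?_⟩
  have h := key p ⟨c, hcN⟩
  rw [hpf] at h
  exact (mem_nonZeroDivisors_iff.mp hc).2 _ (by simpa [Polynomial.aeval_def] using h.symm)

/-- If `b` is integral over `R`, `i ∈ J` and `b * i` lies in `R`, then `b * i` is integral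
over the ideal `J`. -/
theorem isIntegralOverIdeal_of_eq_mul {R A : Type*} [CommRing R] [CommRing A] [Algebra R A]
    (hinj : Function.Injective (algebraMap R A)) {J : Ideal R} {b : A} (hb : IsIntegral R b)
    {i r : R} (hi : i ∈ J) (hr : algebraMap R A r = algebraMap R A i * b) :
    IsIntegralOverIdeal J r := by
  obtain ⟨p, hp, hpb⟩ := hb
  refine ⟨p.scaleRoots i, (Polynomial.monic_scaleRoots_iff i).mpr hp, fun k _ => ?_, hinj ?_⟩
  · rw [Polynomial.coeff_scaleRoots, Polynomial.natDegree_scaleRoots]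
    exact Ideal.mul_mem_left _ _ (Ideal.pow_mem_pow hi _)
  · rw [map_zero, ← Polynomial.aeval_algebraMap_apply_eq_algebraMap_eval, hr]
    exact Polynomial.scaleRoots_aeval_eq_zero hpb

theorem mem_idl {R : Type*} [CommRing R] {I : Ideal R} {x : FractionRing R} :
    x ∈ idl R I ↔ ∃ r ∈ I, algebraMap R (FractionRing R) r = x :=
  Iff.rfl

/-- A finitely generated submodule of `Q(R)` has a common denominator. -/
theorem exists_algebraMap_mem_one_div {R : Type*} [CommRing R]
    {N : Submodule R (FractionRing R)} (hN : N.FG) :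
    ∃ y ∈ R⁰, algebraMap R (FractionRing R) y ∈ 1 / N := by
  obtain ⟨s, rfl⟩ := hN
  obtain ⟨y, hy⟩ := IsLocalization.exist_integer_multiples_of_finset R⁰ s
  refine ⟨y, y.2, Submodule.mem_div_iff_forall_mul_mem.mpr fun z hz => ?_⟩
  induction hz using Submodule.span_induction with
  | mem z hz =>
    obtain ⟨r, hr⟩ := hy z hz
    exact Submodule.mem_one.mpr ⟨r, by rw [hr, Algebra.smul_def]⟩
  | zero => simp
  | add u v _ _ hu hv => rw [mul_add]; exact add_mem hu hv
  | smul a u _ hu => rw [mul_smul_comm]; exact Submodule.smul_mem _ _ hu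

/-- If `R̄` is finite over the noetherian ring `R`, then `R : C ⊆ R̄`. -/
theorem one_div_condC_le {R : Type*} [CommRing R] [IsNoetherianRing R] (hfin : (Rbar R).FG) :
    1 / condC R ≤ Rbar R := by
  intro x hx
  obtain ⟨y, hy, hyC⟩ := exists_algebraMap_mem_one_div hfin
  have hC : condC R ≤ 1 := fun c hc => by
    have h := Submodule.mem_div_iff_forall_mul_mem.mp hc 1 (integralClosure R _).one_mem
    rwa [mul_one] at h
  have hfg : (condC R).FG :=
    Submodule.FG.of_le (by rw [Submodule.one_eq_span]; exact Submodule.fg_span_singleton _) hC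
  have hyu : algebraMap R (FractionRing R) y ∈ (FractionRing R)⁰ :=
    (IsLocalization.map_units (FractionRing R) (⟨y, hy⟩ : R⁰)).mem_nonZeroDivisors
  refine isIntegral_of_mul_mem_of_fg hfg hyC hyu fun c hc => ?_
  refine Submodule.mem_div_iff_forall_mul_mem.mpr fun z hz => ?_
  rw [mul_assoc]
  refine Submodule.mem_div_iff_forall_mul_mem.mp hx _ ?_
  refine Submodule.mem_div_iff_forall_mul_mem.mpr fun w hw => ?_
  rw [mul_assoc]
  exact Submodule.mem_div_iff_forall_mul_mem.mp hc _ ((integralClosure R _).mul_mem hz hw)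

theorem statement_5
    (R : Type*) [CommRing R] [IsNoetherianRing R] [IsLocalRing R] [IsReduced R]
    (hdim : ringKrullDim R = 1)
    (hCM : ∃ x ∈ IsLocalRing.maximalIdeal R, x ∈ R⁰)
    [Infinite (IsLocalRing.ResidueField R)]
    (hfin : (Subalgebra.toSubmodule (integralClosure R (FractionRing R))).FG)
    (I : Ideal R) (hIreg : ∃ r ∈ I, r ∈ R⁰) (hIproper : I ≠ ⊤)
    (hInp : ¬∃ r : R, I = Ideal.span {r})
    (hIrefl : (1 : Submodule R (FractionRing R)) / (1 / idl R I) = idl R I)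
    (hCI : condC R ≤ idl R I)
    (J : Ideal R) (hJreg : ∃ r ∈ J, r ∈ R⁰)
    (hJic : ∀ r : R, IsIntegralOverIdeal J r → r ∈ J)
    (hIJ : I ≤ J) :
    idl R J / idl R J ≤ idl R I / idl R I := by
  intro a ha
  rw [Submodule.mem_div_iff_forall_mul_mem] at ha ⊢
  intro x hx
  rw [← hIrefl, Submodule.mem_div_iff_forall_mul_mem]
  intro b hb
  have hbint : IsIntegral R b := one_div_condC_le hfin <|
    Submodule.mem_div_iff_forall_mul_mem.mpr fun c hc =>
      Submodule.mem_div_iff_forall_mul_mem.mp hb c (hCI hc)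
  obtain ⟨r, hr⟩ := Submodule.mem_one.mp (Submodule.mem_div_iff_forall_mul_mem.mp hb x hx)
  obtain ⟨i, hi, rfl⟩ := mem_idl.mp hx
  have hrJ : r ∈ J := hJic r <|
    isIntegralOverIdeal_of_eq_mul (IsFractionRing.injective R (FractionRing R)) hbint (hIJ hi)
      (hr.trans (mul_comm _ _))
  obtain ⟨s, -, hs⟩ := mem_idl.mp (ha _ (mem_idl.mpr ⟨r, hrJ, rfl⟩))
  exact Submodule.mem_one.mpr ⟨s, by rw [hs, hr]; ring⟩
end
end

section
/- Let ω_R be a canonical ideal of R with R ⊆ ω_R ⊆ R̄. If I is a fractional ideal of R such that ω_R ⊆ I:I, then I is reflexive. -/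
open scoped nonZeroDivisors

noncomputable section

/-- Iterated colon ideals: `(A : B) : C = A : BC`. -/
theorem Submodule.div_div_eq_div_mul {R A : Type*} [CommSemiring R] [CommSemiring A] [Algebra R A]
    (I J K : Submodule R A) : I / J / K = I / (J * K) :=
  eq_of_forall_le_iff fun L => by
    rw [Submodule.le_div_iff_mul_le, Submodule.le_div_iff_mul_le, Submodule.le_div_iff_mul_le,
      mul_assoc, mul_comm K J]

theorem statement_8
    (R : Type*) [CommRing R] [IsNoetherianRing R] [IsLocalRing R] [IsReduced R]
    (hdim : ringKrullDim R = 1)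
    (hCM : ∃ x ∈ IsLocalRing.maximalIdeal R, x ∈ R⁰)
    [Infinite (IsLocalRing.ResidueField R)]
    (hfin : (Subalgebra.toSubmodule (integralClosure R (FractionRing R))).FG)
    (ω : Submodule R (FractionRing R)) (hωfrac : IsFracIdeal ω)
    (hω1 : 1 ≤ ω) (hω2 : ω ≤ Rbar R)
    (hωcan : ∀ I : Submodule R (FractionRing R), IsFracIdeal I → ω / (ω / I) = I)
    (I : Submodule R (FractionRing R)) (hI : IsFracIdeal I)
    (hωII : ω ≤ I / I) :
    (1 : Submodule R (FractionRing R)) / (1 / I) = I := by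
  have one_frac : IsFracIdeal (1 : Submodule R (FractionRing R)) :=
    ⟨⟨1, Submodule.one_le.mp le_rfl⟩, 1, one_mem _, by simp [smulQ, ← Submodule.one_eq_span]⟩
  have div_self : ω / ω = 1 := by
    have h : ω / 1 = ω := eq_of_forall_le_iff fun L => by
      rw [Submodule.le_div_iff_mul_le, mul_one]
    simpa only [h] using hωcan 1 one_frac
  have mul_eq {J : Submodule R (FractionRing R)} (hJ : ω * J ≤ J) : ω * J = J :=
    le_antisymm hJ (by simpa using mul_le_mul_left hω1 J)
  have one_div {J : Submodule R (FractionRing R)} (hJ : ω * J ≤ J) : 1 / J = ω / J := by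
    rw [← div_self, Submodule.div_div_eq_div_mul, mul_eq hJ]
  have hωI : ω * I ≤ I := Submodule.le_div_iff_mul_le.mp hωII
  have hωdual : ω * (ω / I) ≤ ω / I := by
    rw [Submodule.le_div_iff_mul_le, mul_right_comm, mul_eq hωI, mul_comm]
    exact Submodule.le_div_iff_mul_le.mp le_rfl
  rw [one_div hωI, one_div hωdual, hωcan I hI]
end
end

section
/- If I is a non-principal reflexive fractional ideal of R, then 𝔪:𝔪 ⊆ I:I; that is, I is a fractional ideal over the ring B = 𝔪:𝔪. -/
open scoped nonZeroDivisors

noncomputable section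

/-- If some product of `x ∈ I` and `j ∈ R : I` is a unit of `R`, then `I` is generated by `x`. -/
lemma eq_span_singleton_of_mul_eq_unit {R K : Type*} [CommRing R] [CommRing K] [Algebra R K]
    {I : Submodule R K} {x j : K} (hx : x ∈ I) (hj : j ∈ 1 / I) (u : Rˣ)
    (h : x * j = algebraMap R K u) : I = Submodule.span R {x} := by
  refine le_antisymm (fun y hy => ?_) ((Submodule.span_singleton_le_iff_mem _ _).2 hx)
  obtain ⟨r, hr⟩ := Submodule.mem_one.1 (Submodule.mem_div_iff_forall_mul_mem.1 hj y hy)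
  refine Submodule.mem_span_singleton.2 ⟨↑u⁻¹ * r, ?_⟩
  have hu : algebraMap R K ↑u⁻¹ * algebraMap R K u = 1 := by
    rw [← map_mul, Units.inv_mul, map_one]
  rw [Algebra.smul_def, map_mul, hr]
  linear_combination y * hu + algebraMap R K ↑u⁻¹ * y * h

theorem statement_9
    (R : Type*) [CommRing R] [IsNoetherianRing R] [IsLocalRing R] [IsReduced R]
    (hdim : ringKrullDim R = 1)
    (hCM : ∃ x ∈ IsLocalRing.maximalIdeal R, x ∈ R⁰)
    [Infinite (IsLocalRing.ResidueField R)]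
    (hfin : (Subalgebra.toSubmodule (integralClosure R (FractionRing R))).FG)
    (I : Submodule R (FractionRing R)) (hI : IsFracIdeal I)
    (hInp : ¬∃ x : FractionRing R, I = Submodule.span R {x})
    (hIrefl : (1 : Submodule R (FractionRing R)) / (1 / I) = I) :
    idl R (IsLocalRing.maximalIdeal R) / idl R (IsLocalRing.maximalIdeal R) ≤ I / I := by
  intro b hb
  refine Submodule.mem_div_iff_forall_mul_mem.2 fun x hx => ?_
  rw [← hIrefl]
  refine Submodule.mem_div_iff_forall_mul_mem.2 fun j hj => ?_
  obtain ⟨r, hr⟩ := Submodule.mem_one.1 (Submodule.mem_div_iff_forall_mul_mem.1 hj x hx)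
  rw [mul_comm] at hr
  have hrm : r ∈ IsLocalRing.maximalIdeal R := by
    rw [IsLocalRing.mem_maximalIdeal, mem_nonunits_iff]
    rintro ⟨u, rfl⟩
    exact hInp ⟨x, eq_span_singleton_of_mul_eq_unit hx hj u hr.symm⟩
  obtain ⟨s, -, hs⟩ := Submodule.mem_div_iff_forall_mul_mem.1 hb (algebraMap R _ r) ⟨r, hrm, rfl⟩
  refine Submodule.mem_one.2 ⟨s, ?_⟩
  rw [mul_assoc, ← hr]
  exact hs
end
end

section
/- Let I be a proper regular ideal of R and J an integrally closed regular ideal of R such that C ⊆ I ⊆ J. Then R:(R:I) = J:(J:I). In particular, I is reflexive if and only if I is J-reflexive. -/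
open scoped nonZeroDivisors

noncomputable section

section CayleyHamilton

variable {R A : Type*} [CommRing R] [CommRing A] [Algebra R A]

/-- The determinant trick for multiplication by an element on a finitely generated submodule. -/
theorem exists_monic_of_forall_mul_mem_smul {M : Submodule R A} (hM : M.FG) (𝔞 : Ideal R) (z : A)
    (hz : ∀ m ∈ M, z * m ∈ 𝔞 • M) :
    ∃ p : Polynomial R, p.Monic ∧ (∀ i, p.coeff i ∈ 𝔞 ^ (p.natDegree - i)) ∧
      ∀ m ∈ M, Polynomial.aeval z p * m = 0 := by
  have : Module.Finite R M := Module.Finite.iff_fg.mpr hM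
  let f : Module.End R M := (Algebra.lmul R A z).restrict
    fun m hm => Submodule.smul_le_right (hz m hm)
  have hf (m : M) : (f m : A) = z * m := rfl
  obtain ⟨p, hp, -, hc, h0⟩ :=
    LinearMap.exists_monic_and_natDegree_eq_and_coeff_mem_pow_and_aeval_eq_zero R f 𝔞 (by
      rintro _ ⟨m, rfl⟩
      have h := hz m m.2
      rw [← hf] at h
      have e : 𝔞 • M = (𝔞 • (⊤ : Submodule R M)).map M.subtype := by
        rw [Submodule.map_smul'', Submodule.map_top, Submodule.range_subtype]
      rw [e] at h
      obtain ⟨w, hw, hwe⟩ := h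
      rwa [← Subtype.ext hwe])
  refine ⟨p, hp, hc, fun m hm => ?_⟩
  have key (q : Polynomial R) (m : M) :
      (Polynomial.aeval f q m : A) = Polynomial.aeval z q * m := by
    induction q using Polynomial.induction_on' with
    | add a b ha hb => simp [ha, hb, add_mul]
    | monomial n c =>
      have hpow (k : ℕ) : ((f ^ k) m : A) = z ^ k * m := by
        induction k with
        | zero => simp
        | succ k ih => rw [pow_succ', Module.End.mul_apply, hf, ih]; ring
      simp [Polynomial.aeval_monomial, Algebra.smul_def, hpow, mul_assoc]
  have := key p ⟨m, hm⟩
  rw [h0] at this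
  simpa using this.symm

/-- An element stabilizing a finitely generated submodule which contains a
non-zero-divisor is integral. -/
theorem isIntegral_of_forall_mul_mem_s11 {M : Submodule R A} (hM : M.FG) {c : A} (hc : c ∈ M)
    (hc0 : c ∈ A⁰) {z : A} (hz : ∀ m ∈ M, z * m ∈ M) : IsIntegral R z := by
  obtain ⟨p, hp, -, h0⟩ := exists_monic_of_forall_mul_mem_smul hM ⊤ z (by simpa using hz)
  exact ⟨p, hp, (mem_nonZeroDivisors_iff.mp hc0).2 _ (h0 c hc)⟩

end CayleyHamilton

section Fractional

variable {R : Type*} [CommRing R]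

theorem one_mem_Rbar : (1 : FractionRing R) ∈ Rbar R :=
  (integralClosure R (FractionRing R)).one_mem

theorem mul_mem_Rbar {x y : FractionRing R} (hx : x ∈ Rbar R) (hy : y ∈ Rbar R) :
    x * y ∈ Rbar R :=
  (integralClosure R (FractionRing R)).mul_mem hx hy

theorem algebraMap_mem_nonZeroDivisors {r : R} (hr : r ∈ R⁰) :
    algebraMap R (FractionRing R) r ∈ (FractionRing R)⁰ :=
  (IsLocalization.map_units (FractionRing R) ⟨r, hr⟩).mem_nonZeroDivisors

theorem idl_le_one (I : Ideal R) : idl R I ≤ 1 := by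
  rintro _ ⟨r, -, rfl⟩
  exact Submodule.mem_one.mpr ⟨r, rfl⟩

theorem algebraMap_mem_idl {I : Ideal R} {r : R} :
    algebraMap R (FractionRing R) r ∈ idl R I ↔ r ∈ I := by
  refine ⟨?_, fun h => ⟨r, h, rfl⟩⟩
  rintro ⟨s, hs, h⟩
  rwa [← IsFractionRing.injective R (FractionRing R) h]

theorem one_le_Rbar : 1 ≤ Rbar R := by
  rw [Submodule.one_le]
  exact one_mem_Rbar

/-- The conductor contains a non-zero-divisor if the normalization is finite. -/
theorem exists_algebraMap_mem_condC (hfin : (Rbar R).FG) :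
    ∃ c ∈ R⁰, algebraMap R (FractionRing R) c ∈ condC R := by
  obtain ⟨s, hs⟩ := hfin
  obtain ⟨b, hb⟩ := IsLocalization.exist_integer_multiples_of_finset R⁰ s
  refine ⟨b, b.2, ?_⟩
  have h : Rbar R ≤ Submodule.comap (Algebra.lmul R (FractionRing R)
      (algebraMap R (FractionRing R) b)) 1 := by
    rw [← hs, Submodule.span_le]
    intro x hx
    obtain ⟨t, ht⟩ := hb x hx
    refine ⟨t, ?_⟩
    simpa [Algebra.smul_def] using ht
  exact fun y hy => h hy

/-- `R : C` is contained in the normalization. -/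
theorem one_div_condC_le_Rbar [IsNoetherianRing R] (hfin : (Rbar R).FG) :
    1 / condC R ≤ Rbar R := by
  obtain ⟨c, hc, hcC⟩ := exists_algebraMap_mem_condC hfin
  have hC1 : condC R ≤ 1 := fun x hx => by simpa using hx 1 one_mem_Rbar
  have hfg : (condC R).FG := by
    have : IsNoetherian R (1 : Submodule R (FractionRing R)) :=
      isNoetherian_of_fg_of_noetherian _ (by
        rw [Submodule.one_eq_span]; exact Submodule.fg_span_singleton _)
    exact (isNoetherian_submodule.mp this) _ hC1
  intro x hx
  refine isIntegral_of_forall_mul_mem_s11 hfg hcC (algebraMap_mem_nonZeroDivisors hc) fun m hm s hs => ?_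
  rw [mul_assoc]
  refine hx _ fun t ht => ?_
  rw [mul_assoc]
  exact hm _ (mul_mem_Rbar hs ht)

/-- An element of `R` lying in `I R̄` is integral over `I`. -/
theorem isIntegralOverIdeal_of_mem_mul_Rbar (hfin : (Rbar R).FG) {I : Ideal R} {r : R}
    (hr : algebraMap R (FractionRing R) r ∈ idl R I * Rbar R) : IsIntegralOverIdeal I r := by
  have e : idl R I * Rbar R = I • Rbar R := by
    apply le_antisymm
    · rw [Submodule.mul_le]
      rintro _ ⟨a, ha, rfl⟩ n hn
      simpa [Algebra.smul_def] using Submodule.smul_mem_smul ha hn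
    · rw [Submodule.smul_le]
      intro a ha n hn
      rw [Algebra.smul_def]
      exact Submodule.mul_mem_mul (algebraMap_mem_idl.mpr ha) hn
  obtain ⟨p, hp, hc, h0⟩ := exists_monic_of_forall_mul_mem_smul hfin I
    (algebraMap R (FractionRing R) r) fun m hm => by
      rw [← e]
      have h := Submodule.mul_mem_mul hr hm
      rw [mul_assoc] at h
      have hS : Rbar R * Rbar R ≤ Rbar R :=
        Submodule.mul_le.mpr fun _ ha _ hb => mul_mem_Rbar ha hb
      exact mul_le_mul_right hS _ h
  refine ⟨p, hp, fun i _ => hc i, IsFractionRing.injective R (FractionRing R) ?_⟩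
  have h := h0 1 one_mem_Rbar
  rwa [mul_one, Polynomial.aeval_algebraMap_apply, ← map_zero (algebraMap R (FractionRing R))] at h

/-- A proper ideal of the normalization `S` which contains a non-zero-divisor `r` of the
one-dimensional ring `R` is killed modulo `r` by some element outside `r S`. -/
theorem exists_notMem_span_mul_mem_span [IsNoetherianRing R] (hdim : Ring.KrullDimLE 1 R)
    {S : Type*} [CommRing S] [Algebra R S] [Algebra.IsIntegral R S] [IsNoetherianRing S]
    {r : R} (hr : r ∈ R⁰) {K : Ideal S} (hrK : algebraMap R S r ∈ K) (hK : K ≠ ⊤) :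
    ∃ b ∉ Ideal.span {algebraMap R S r}, ∀ k ∈ K, k * b ∈ Ideal.span {algebraMap R S r} := by
  obtain ⟨m, hm, hKm⟩ := Ideal.exists_le_maximal K hK
  have hmin : m ∈ (Ideal.span {algebraMap R S r}).minimalPrimes := by
    refine ⟨⟨hm.isPrime, by simpa using hKm hrK⟩, fun P ⟨hP, hrP⟩ hPm => ?_⟩
    have hrP' : r ∈ P.comap (algebraMap R S) := hrP (Ideal.mem_span_singleton_self _)
    have hPmax : (P.comap (algebraMap R S)).IsMaximal := by
      refine (Ring.krullDimLE_one_iff.mp hdim _ (hP.comap _)).resolve_left fun h => ?_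
      exact Set.disjoint_left.mp (Ideal.disjoint_nonZeroDivisors_of_mem_minimalPrimes h) hrP' hr
    exact ((Ideal.isMaximal_of_isIntegral_of_isMaximal_comap P hPmax).eq_of_le hm.ne_top hPm).ge
  obtain ⟨b, hb⟩ := Submodule.exists_eq_colon_of_mem_minimalPrimes
    (N := Ideal.span {algebraMap R S r}) (x := (1 : S)) (I := m) (by
      convert hmin using 1
      congr 1
      ext x
      simp [Submodule.mem_colon_singleton])
  refine ⟨b, fun h => hm.ne_top ?_, fun k hk => ?_⟩
  · rw [Ideal.eq_top_iff_one, hb, Submodule.mem_colon_singleton]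
    simpa using h
  · have := hKm hk
    rw [hb, Submodule.mem_colon_singleton] at this
    simpa using this

/-- Regular ideals extended to the normalization of a one-dimensional ring are invertible there. -/
theorem one_mem_idl_mul_Rbar_div [IsNoetherianRing R] (hdim : Ring.KrullDimLE 1 R)
    (hfin : (Rbar R).FG) {J : Ideal R} {r : R} (hrJ : r ∈ J) (hr : r ∈ R⁰) :
    1 ∈ idl R J * (Rbar R / idl R J) := by
  set D := Rbar R / idl R J with hD
  have hrQ : algebraMap R (FractionRing R) r ∈ idl R J := algebraMap_mem_idl.mpr hrJ
  have hrU : IsUnit (algebraMap R (FractionRing R) r) :=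
    IsLocalization.map_units (FractionRing R) ⟨r, hr⟩
  have hSD {s d : FractionRing R} (hs : s ∈ Rbar R) (hd : d ∈ D) : s * d ∈ D := fun y hy => by
    rw [mul_assoc]
    exact mul_mem_Rbar hs (hd y hy)
  have h1D : 1 ∈ D := Submodule.one_mem_div.mpr ((idl_le_one J).trans one_le_Rbar)
  have hfinS : Module.Finite R (integralClosure R (FractionRing R)) := Module.Finite.iff_fg.mpr hfin
  have hN : IsNoetherianRing (integralClosure R (FractionRing R)) := IsNoetherianRing.of_finite R _
  have hDfg : D.FG := by
    have hle : D.map (Algebra.lmul R (FractionRing R) (algebraMap R (FractionRing R) r)) ≤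
        Rbar R := by
      rintro _ ⟨d, hd, rfl⟩
      simpa [mul_comm, Algebra.smul_def] using hd _ hrQ
    have : IsNoetherian R (Rbar R) := isNoetherian_of_fg_of_noetherian _ hfin
    exact Submodule.fg_of_fg_map_injective _ (fun x y h => hrU.mul_left_cancel h)
      (isNoetherian_submodule.mp this _ hle)
  let K : Ideal (integralClosure R (FractionRing R)) :=
    { carrier := {s | (s : FractionRing R) ∈ idl R J * D}
      add_mem' := fun ha hb => (idl R J * D).add_mem ha hb
      zero_mem' := (idl R J * D).zero_mem
      smul_mem' := fun s x hx => by
        have h : idl R J * D ≤ (idl R J * D).comap (Algebra.lmul R (FractionRing R) s) := by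
          rw [Submodule.mul_le]
          intro a ha d hd
          have := Submodule.mul_mem_mul ha (hSD s.2 hd)
          simpa [mul_left_comm] using this
        exact h hx }
  have hmemK {s : integralClosure R (FractionRing R)} :
      s ∈ K ↔ (s : FractionRing R) ∈ idl R J * D := Iff.rfl
  by_contra hK
  obtain ⟨b, hb, hbK⟩ := exists_notMem_span_mul_mem_span hdim
    (S := integralClosure R (FractionRing R)) hr (K := K)
    (hmemK.mpr (by simpa using Submodule.mul_mem_mul hrQ h1D))
    (fun h => hK ((Ideal.eq_top_iff_one K).mp h))
  obtain ⟨u, hu⟩ := hrU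
  have hz : (↑u⁻¹ * b : FractionRing R) ∈ Rbar R := by
    refine isIntegral_of_forall_mul_mem_s11 hDfg h1D (one_mem _) fun d hd y hy => ?_
    have hyd : d * y ∈ Rbar R := hd y hy
    obtain ⟨t, ht⟩ := Ideal.mem_span_singleton.mp (hbK ⟨d * y, hyd⟩
      (hmemK.mpr (by simpa [mul_comm] using Submodule.mul_mem_mul hy hd)))
    have ht' : d * y * b = u * (t : FractionRing R) := by
      rw [hu]; exact congrArg Subtype.val ht
    have : ↑u⁻¹ * (b : FractionRing R) * d * y = t := by
      rw [← u.inv_mul_cancel_left (t : FractionRing R), ← ht']; ring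
    rw [this]
    exact t.2
  refine hb (Ideal.mem_span_singleton.mpr ⟨⟨_, hz⟩, Subtype.ext ?_⟩)
  change (b : FractionRing R) = algebraMap R (FractionRing R) r * (↑u⁻¹ * b)
  rw [← hu, u.mul_inv_cancel_left]

/-- The reflexive hull of a regular ideal containing the conductor lies in its extension to the
normalization. -/
theorem one_div_one_div_le_mul_Rbar [IsNoetherianRing R] (hdim : Ring.KrullDimLE 1 R)
    (hfin : (Rbar R).FG) {J : Ideal R} (hJ : ∃ r ∈ J, r ∈ R⁰) :
    1 / (1 / idl R J) ≤ idl R J * Rbar R := by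
  obtain ⟨r, hrJ, hr⟩ := hJ
  intro y hy
  have hyD : ∀ d ∈ Rbar R / idl R J, d * y ∈ Rbar R := fun d hd => by
    refine one_div_condC_le_Rbar hfin fun c hc => ?_
    have := hy (c * d) fun j hj => by
      rw [mul_assoc]
      exact hc _ (hd j hj)
    convert this using 1
    ring
  have h : idl R J * (Rbar R / idl R J) ≤
      (idl R J * Rbar R).comap (Algebra.lmul R (FractionRing R) y) := by
    rw [Submodule.mul_le]
    intro a ha d hd
    have := Submodule.mul_mem_mul ha (hyD d hd)
    rw [mul_comm d y, mul_left_comm] at this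
    exact this
  simpa using h (one_mem_idl_mul_Rbar_div hdim hfin hrJ hr)

end Fractional

theorem statement_11
    (R : Type*) [CommRing R] [IsNoetherianRing R] [IsLocalRing R] [IsReduced R]
    (hdim : ringKrullDim R = 1)
    (hCM : ∃ x ∈ IsLocalRing.maximalIdeal R, x ∈ R⁰)
    [Infinite (IsLocalRing.ResidueField R)]
    (hfin : (Subalgebra.toSubmodule (integralClosure R (FractionRing R))).FG)
    (I : Ideal R) (hIreg : ∃ r ∈ I, r ∈ R⁰) (hIproper : I ≠ ⊤)
    (hCI : condC R ≤ idl R I)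
    (J : Ideal R) (hJreg : ∃ r ∈ J, r ∈ R⁰)
    (hJic : ∀ r : R, IsIntegralOverIdeal J r → r ∈ J)
    (hIJ : I ≤ J) :
    (1 : Submodule R (FractionRing R)) / (1 / idl R I) = idl R J / (idl R J / idl R I) ∧
    (((1 : Submodule R (FractionRing R)) / (1 / idl R I) = idl R I) ↔
      idl R J / (idl R J / idl R I) = idl R I) := by
  have hdim' : Ring.KrullDimLE 1 R := Ring.krullDimLE_iff.mpr (by simp [hdim])
  have hmem {x : FractionRing R} (h1 : x ∈ (1 : Submodule R (FractionRing R)))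
      (hx : x ∈ idl R J * Rbar R) : x ∈ idl R J := by
    obtain ⟨r, rfl⟩ := Submodule.mem_one.mp h1
    exact algebraMap_mem_idl.mpr (hJic r (isIntegralOverIdeal_of_mem_mul_Rbar hfin hx))
  have hIJ' : idl R I ≤ idl R J := Submodule.map_mono hIJ
  have hdual : 1 / idl R I ≤ Rbar R := fun x hx =>
    one_div_condC_le_Rbar hfin fun c hc => hx c (hCI hc)
  have hmul {x j : FractionRing R} (hx : x ∈ 1 / idl R I) (hj : j ∈ idl R J)
      (h : x * j ∈ (1 : Submodule R (FractionRing R))) : x * j ∈ idl R J := by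
    refine hmem h ?_
    rw [mul_comm x]
    exact Submodule.mul_mem_mul hj (hdual hx)
  have hJI : idl R J / idl R I = 1 / idl R I :=
    le_antisymm (fun x hx i hi => idl_le_one J (hx i hi))
      fun x hx i hi => hmul hx (hIJ' hi) (hx i hi)
  have key : (1 : Submodule R (FractionRing R)) / (1 / idl R I) =
      idl R J / (idl R J / idl R I) := by
    rw [hJI]
    refine le_antisymm (fun y hy w hw => ?_) fun y hy w hw => idl_le_one J (hy w hw)
    have hyJ : y ∈ idl R J := by
      refine hmem ?_ (one_div_one_div_le_mul_Rbar hdim' hfin hJreg fun w hw =>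
        hy w fun i hi => hw i (hIJ' hi))
      simpa using hy 1 (Submodule.one_mem_div.mpr (idl_le_one I))
    have hyw := hy w hw
    rw [mul_comm] at hyw ⊢
    exact hmul hw hyJ hyw
  exact ⟨key, by rw [key]⟩
end
end
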